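/- Suppose the standing assumptions hold and consider one step of the explicit scheme: g^k ∈ ∂f(x^k), x^{k+1} = argmin_{x∈X} α^k⟨g^k + L_d(G) x^k + E_s(G) u^k, x⟩ + B_ψ(x, x^k), u^{k+1} = u^k + α^k E_s(G)ᵀ x^{k+1}, with α^k > 0. Let λ be the largest eigenvalue of L_d(G) and set c = d − α^k s (entrywise). Then V(x^{k+1}, u^{k+1}) − V(x^k, u^k) ≤ α^k⟨g^k + E_s(G) u*, x* − x^{k+1}⟩ − (α^k/2)⟨L_d(G) x^k, x^k⟩ − ((1 − α^k λ)/2)‖x^{k+1} − x^k‖₂² − (α^k/2)⟨L_c(G) x^{k+1}, x^{k+1}⟩. -/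

import Mathlib

open scoped RealInnerProductSpace
open Finset

noncomputable section

/-- `ℝ^n` with the Euclidean (l2) structure. -/
abbrev Vec (n : ℕ) := EuclideanSpace ℝ (Fin n)

/-- Entry `(i, e)` of the incidence matrix `E(G)` of an oriented graph:
`+1` if `i` is the head of edge `e`, `-1` if it is the tail, `0` otherwise. -/
def incid {V Ed : Type*} [DecidableEq V] (head tail : Ed → V) (i : V) (e : Ed) : ℝ :=
  if i = head e then 1 else if i = tail e then -1 else 0

/-- Action of `E_w(G) = (E(G) diag(√w)) ⊗ I_n` on an edge-indexed block vector. -/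
def esOp {n : ℕ} {V Ed : Type*} [Fintype Ed] [DecidableEq V] (head tail : Ed → V)
    (w : Ed → ℝ) (u : Ed → Vec n) : V → Vec n :=
  fun i => ∑ e, (incid head tail i e * Real.sqrt (w e)) • u e

/-- Action of `E_w(G)ᵀ = (diag(√w) E(G)ᵀ) ⊗ I_n` on a node-indexed block vector. -/
def esTOp {n : ℕ} {V Ed : Type*} [Fintype V] [DecidableEq V] (head tail : Ed → V)
    (w : Ed → ℝ) (x : V → Vec n) : Ed → Vec n :=
  fun e => ∑ i, (incid head tail i e * Real.sqrt (w e)) • x i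

/-- Action of the weighted Laplacian `L_w(G) = (E(G) diag(w) E(G)ᵀ) ⊗ I_n`. -/
def lapOp {n : ℕ} {V Ed : Type*} [Fintype V] [Fintype Ed] [DecidableEq V] (head tail : Ed → V)
    (w : Ed → ℝ) (x : V → Vec n) : V → Vec n :=
  fun i => ∑ j, (∑ e, incid head tail i e * w e * incid head tail j e) • x j

/-- Euclidean inner product on the node space `ℝ^{|V| n}`. -/
def innV {n : ℕ} {V : Type*} [Fintype V] (x y : V → Vec n) : ℝ := ∑ i, ⟪x i, y i⟫

/-- Euclidean inner product on the edge space `ℝ^{|Ed| n}`. -/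
def innE {n : ℕ} {Ed : Type*} [Fintype Ed] (u v : Ed → Vec n) : ℝ := ∑ e, ⟪u e, v e⟫

/-- The Cartesian product `X = X₀^{|V|}`. -/
def prodSet {n : ℕ} (V : Type*) (X0 : Set (Vec n)) : Set (V → Vec n) := {x | ∀ i, x i ∈ X0}

/-- `f(x) = ∑ᵢ fᵢ(xᵢ)`. -/
def sumF {n : ℕ} {V : Type*} [Fintype V] (f : V → Vec n → ℝ) (x : V → Vec n) : ℝ :=
  ∑ i, f i (x i)

/-- Bregman divergence `B_ψ(x', x)` for `ψ(x) = ∑ᵢ ψ₀(xᵢ)` with `∇ψ₀ = g0`. -/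
def Bpsi {n : ℕ} {V : Type*} [Fintype V] (psi0 : Vec n → ℝ) (g0 : Vec n → Vec n)
    (x' x : V → Vec n) : ℝ :=
  (∑ i, psi0 (x' i)) - (∑ i, psi0 (x i)) - ∑ i, ⟪g0 (x i), x' i - x i⟫

/-- `g ∈ ∂F(x)`: `g` is a subgradient of `F` at `x` (relative to the domain `Xs`). -/
def IsSubgrad {n : ℕ} {V : Type*} [Fintype V] (F : (V → Vec n) → ℝ) (Xs : Set (V → Vec n))
    (x g : V → Vec n) : Prop :=
  ∀ x' ∈ Xs, F x' - F x ≥ innV (x' - x) g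

/-- The Lyapunov function `V(x, u) = B_ψ(x*, x) + (1/2)‖u − u*‖₂²`. -/
def Vlyap {n : ℕ} {V Ed : Type*} [Fintype V] [Fintype Ed] (psi0 : Vec n → ℝ)
    (g0 : Vec n → Vec n) (xstar : V → Vec n) (ustar : Ed → Vec n)
    (x : V → Vec n) (u : Ed → Vec n) : ℝ :=
  Bpsi psi0 g0 xstar x + (1/2) * innE (u - ustar) (u - ustar)

/-- The shifted Lagrangian `ℓ(x) = f(x) + ⟨E_s(G) u*, x⟩`. -/
def ellF {n : ℕ} {V Ed : Type*} [Fintype V] [Fintype Ed] [DecidableEq V]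
    (f : V → Vec n → ℝ) (head tail : Ed → V) (sw : Ed → ℝ) (ustar : Ed → Vec n)
    (x : V → Vec n) : ℝ :=
  sumF f x + innV (esOp head tail sw ustar) x

section Graph

variable {n : ℕ} {V Ed : Type*} [Fintype V] [DecidableEq V]

/-- Action of `E(G)ᵀ ⊗ I_n`: the unweighted edge differences. -/
def edgeDiff (head tail : Ed → V) (x : V → Vec n) : Ed → Vec n :=
  fun e => ∑ i, incid head tail i e • x i

theorem esTOp_eq_smul_edgeDiff (head tail : Ed → V) (w : Ed → ℝ) (x : V → Vec n) (e : Ed) :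
    esTOp head tail w x e = √(w e) • edgeDiff head tail x e := by
  simp only [esTOp, edgeDiff, smul_sum, smul_smul, mul_comm]

theorem edgeDiff_eq_zero_of_esTOp_eq_zero (head tail : Ed → V) {w : Ed → ℝ}
    (hw : ∀ e, 0 < w e) {x : V → Vec n} (hx : esTOp head tail w x = 0) (e : Ed) :
    edgeDiff head tail x e = 0 := by
  have h := congrFun hx e
  rw [esTOp_eq_smul_edgeDiff, Pi.zero_apply, smul_eq_zero] at h
  exact h.resolve_left (Real.sqrt_pos.2 (hw e)).ne'

variable [Fintype Ed]

theorem innV_lapOp (head tail : Ed → V) (w : Ed → ℝ) (x y : V → Vec n) :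
    innV (lapOp head tail w x) y
      = ∑ e, w e * ⟪edgeDiff head tail x e, edgeDiff head tail y e⟫ := by
  simp only [innV, lapOp, edgeDiff, sum_inner, inner_sum, real_inner_smul_left,
    real_inner_smul_right, mul_sum, sum_mul]
  rw [sum_congr rfl fun _ _ => sum_comm, sum_comm]
  refine sum_congr rfl fun e _ => ?_
  exact sum_congr rfl fun j _ => sum_congr rfl fun i _ => by ring

theorem innV_lapOp_comm (head tail : Ed → V) (w : Ed → ℝ) (x y : V → Vec n) :
    innV (lapOp head tail w x) y = innV (lapOp head tail w y) x := by
  simp only [innV_lapOp, real_inner_comm]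

theorem innV_esOp (head tail : Ed → V) (w : Ed → ℝ) (u : Ed → Vec n) (x : V → Vec n) :
    innV (esOp head tail w u) x = innE u (esTOp head tail w x) := by
  simp only [innV, innE, esOp, esTOp, sum_inner, inner_sum, real_inner_smul_left,
    real_inner_smul_right]
  exact sum_comm

theorem innE_esTOp_self (head tail : Ed → V) {w : Ed → ℝ} (hw : ∀ e, 0 < w e) (x : V → Vec n) :
    innE (esTOp head tail w x) (esTOp head tail w x) = innV (lapOp head tail w x) x := by
  simp only [innE, innV_lapOp, esTOp_eq_smul_edgeDiff, real_inner_smul_left,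
    real_inner_smul_right, ← mul_assoc, Real.mul_self_sqrt (hw _).le]

theorem innV_lapOp_sub_smul (head tail : Ed → V) (d s : Ed → ℝ) (a : ℝ) (x y : V → Vec n) :
    innV (lapOp head tail (fun e => d e - a * s e) x) y
      = innV (lapOp head tail d x) y - a * innV (lapOp head tail s x) y := by
  simp only [innV_lapOp, mul_sum, ← sum_sub_distrib]
  exact sum_congr rfl fun e _ => by ring

theorem innV_lapOp_sub_self (head tail : Ed → V) (w : Ed → ℝ) (x y : V → Vec n) :
    innV (lapOp head tail w (x - y)) (x - y)
      = innV (lapOp head tail w x) x - 2 * innV (lapOp head tail w y) x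
        + innV (lapOp head tail w y) y := by
  have h (e : Ed) : edgeDiff head tail (x - y) e
      = edgeDiff head tail x e - edgeDiff head tail y e := by
    simp [edgeDiff, smul_sub]
  simp only [innV_lapOp, h, mul_sum, ← sum_sub_distrib, ← sum_add_distrib]
  refine sum_congr rfl fun e _ => ?_
  rw [real_inner_sub_sub_self, real_inner_comm (edgeDiff head tail y e)]
  ring

/-- The weighted Laplacian as a linear operator on the Euclidean node space. -/
def lapLin (head tail : Ed → V) (w : Ed → ℝ) :
    PiLp 2 (fun _ : V => Vec n) →ₗ[ℝ] PiLp 2 (fun _ : V => Vec n) where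
  toFun x := WithLp.toLp 2 (lapOp head tail w x)
  map_add' x y := by
    ext i : 1
    simp [lapOp, smul_add, sum_add_distrib]
  map_smul' c x := by
    ext i : 1
    simp [lapOp, smul_sum, smul_comm c]

theorem lapLin_isSymmetric (head tail : Ed → V) (w : Ed → ℝ) :
    (lapLin (n := n) head tail w).IsSymmetric := fun x y => by
  rw [real_inner_comm _ x]
  exact innV_lapOp_comm head tail w (x : V → Vec n) y

theorem innV_lapOp_self_le (head tail : Ed → V) (w : Ed → ℝ) {lam : ℝ}
    (hlam : ∀ μ : ℝ, (∃ v : V → Vec n, v ≠ 0 ∧ lapOp head tail w v = μ • v) → μ ≤ lam)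
    (x : V → Vec n) :
    innV (lapOp head tail w x) x ≤ lam * innV x x := by
  set T := lapLin (n := n) head tail w
  have hT : T.IsSymmetric := lapLin_isSymmetric head tail w
  let b := hT.eigenvectorBasis rfl
  have hle (i) : hT.eigenvalues rfl i ≤ lam := by
    refine hlam _ ⟨WithLp.ofLp (b i), fun h => ?_, ?_⟩
    · exact b.toBasis.ne_zero i (by simpa using h)
    · exact congrArg WithLp.ofLp (hT.apply_eigenvectorBasis rfl i)
  let v : PiLp 2 (fun _ : V => Vec n) := WithLp.toLp 2 x
  have h1 : innV (lapOp head tail w x) x = ⟪T v, v⟫ := rfl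
  have h2 : innV x x = ⟪v, v⟫ := rfl
  rw [h1, h2, ← b.sum_inner_mul_inner (T v) v, ← b.sum_inner_mul_inner v v, mul_sum]
  refine sum_le_sum fun i _ => ?_
  have h3 : ⟪T v, b i⟫ = hT.eigenvalues rfl i * ⟪v, b i⟫ := by
    rw [hT v (b i), hT.apply_eigenvectorBasis rfl i]
    exact real_inner_smul_right _ _ _
  rw [h3, real_inner_comm v (b i), mul_assoc]
  exact mul_le_mul_of_nonneg_right (hle i) (mul_self_nonneg _)

end Graph

section Convex

variable {n : ℕ}

theorem hasDerivWithinAt_comp_segment {X0 : Set (Vec n)} (hX : Convex ℝ X0) {p : Vec n → ℝ}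
    {g y z : Vec n} (hy : y ∈ X0) (hz : z ∈ X0) (hp : HasGradientWithinAt p g X0 y) :
    HasDerivWithinAt (fun t : ℝ => p (y + t • (z - y))) ⟪g, z - y⟫ (Set.Icc 0 1) 0 := by
  have hline : HasDerivWithinAt (fun t : ℝ => y + t • (z - y)) (z - y) (Set.Icc 0 1) 0 := by
    simpa using ((hasDerivWithinAt_id (0 : ℝ) (Set.Icc 0 1)).smul_const (z - y)).const_add y
  have := hp.hasFDerivWithinAt.comp_hasDerivWithinAt_of_eq (0 : ℝ) hline
    (fun t ht => hX.add_smul_sub_mem hy hz ht) (by simp)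
  simpa [Function.comp_def] using this

theorem nonneg_of_hasDerivWithinAt_of_le {φ : ℝ → ℝ} {φ' : ℝ}
    (hφ : HasDerivWithinAt φ φ' (Set.Icc 0 1) 0) (hmin : ∀ t ∈ Set.Icc (0 : ℝ) 1, φ 0 ≤ φ t) :
    0 ≤ φ' := by
  have hloc : IsLocalMinOn φ (Set.Icc 0 1) 0 := (isMinOn_iff.2 hmin).localize
  have hcone : (1 : ℝ) - 0 ∈ posTangentConeAt (Set.Icc (0 : ℝ) 1) 0 :=
    sub_mem_posTangentConeAt_of_segment_subset (segment_eq_Icc zero_le_one).subset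
  simpa using hloc.hasFDerivWithinAt_nonneg hφ.hasFDerivWithinAt hcone

/-- The first-order lower bound for a `1`-strongly convex function. -/
theorem half_norm_sub_sq_le_of_stronglyConvex {X0 : Set (Vec n)} {p : Vec n → ℝ} {g y z : Vec n}
    (hp : HasGradientWithinAt p g X0 y)
    (hsc : ConvexOn ℝ X0 (fun y => p y - (1 / 2) * ‖y‖ ^ 2)) (hy : y ∈ X0) (hz : z ∈ X0) :
    1 / 2 * ‖z - y‖ ^ 2 ≤ p z - p y - ⟪g, z - y⟫ := by
  have hpoint (t : ℝ) (ht : t ∈ Set.Icc (0 : ℝ) 1) :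
      p (y + t • (z - y)) ≤ p y + t * (p z - p y) - 1 / 2 * (t * (1 - t)) * ‖z - y‖ ^ 2 := by
    have h := hsc.2 hy hz (sub_nonneg.2 ht.2) ht.1 (by ring)
    have hyz : (1 - t) • y + t • z = y + t • (z - y) := by module
    simp only [smul_eq_mul, hyz] at h
    have e1 : ‖y + t • (z - y)‖ ^ 2
        = ‖y‖ ^ 2 + 2 * t * (⟪y, z⟫ - ‖y‖ ^ 2) + t ^ 2 * ‖z - y‖ ^ 2 := by
      rw [norm_add_sq_real, norm_smul, real_inner_smul_right, inner_sub_right,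
        real_inner_self_eq_norm_sq, mul_pow, Real.norm_eq_abs, sq_abs]
      ring
    have e2 : ‖z - y‖ ^ 2 = ‖z‖ ^ 2 - 2 * ⟪y, z⟫ + ‖y‖ ^ 2 := by
      rw [norm_sub_sq_real, real_inner_comm]
    rw [e1] at h
    have e3 : ⟪y, z⟫ = (‖z‖ ^ 2 + ‖y‖ ^ 2 - ‖z - y‖ ^ 2) / 2 := by rw [e2]; ring
    rw [e3] at h
    linarith
  have hquad : HasDerivWithinAt
      (fun t : ℝ => p y + t * (p z - p y) - 1 / 2 * (t * (1 - t)) * ‖z - y‖ ^ 2)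
      (p z - p y - 1 / 2 * ‖z - y‖ ^ 2) (Set.Icc 0 1) 0 := by
    have hid := hasDerivWithinAt_id (0 : ℝ) (Set.Icc 0 1)
    have h := ((hid.mul_const (p z - p y)).const_add (p y)).sub
      (((hid.mul (hid.const_sub 1)).const_mul (1 / 2)).mul_const (‖z - y‖ ^ 2))
    exact h.congr_deriv (by simp)
  have hdiff := hquad.sub (hasDerivWithinAt_comp_segment hsc.1 hy hz hp)
  have := nonneg_of_hasDerivWithinAt_of_le hdiff fun t ht => by
    simpa using hpoint t ht
  linarith

variable {V : Type*} [Fintype V]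

theorem half_innV_le_Bpsi {X0 : Set (Vec n)} {psi0 : Vec n → ℝ} {g0 : Vec n → Vec n}
    (hgrad : ∀ y ∈ X0, HasGradientWithinAt psi0 (g0 y) X0 y)
    (hsc : ConvexOn ℝ X0 (fun y => psi0 y - (1 / 2) * ‖y‖ ^ 2)) {x y : V → Vec n}
    (hx : x ∈ prodSet V X0) (hy : y ∈ prodSet V X0) :
    1 / 2 * innV (x - y) (x - y) ≤ Bpsi psi0 g0 x y := by
  simp only [innV, Bpsi, mul_sum, ← sum_sub_distrib, Pi.sub_apply]
  refine sum_le_sum fun i _ => ?_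
  rw [real_inner_self_eq_norm_sq]
  exact half_norm_sub_sq_le_of_stronglyConvex (hgrad _ (hy i)) hsc (hy i) (hx i)

theorem innV_sub_right (x y z : V → Vec n) : innV x (y - z) = innV x y - innV x z := by
  simp [innV, inner_sub_right]

theorem innV_add_left (x y z : V → Vec n) : innV (x + y) z = innV x z + innV y z := by
  simp [innV, inner_add_left, sum_add_distrib]

/-- The three-point inequality for a Bregman proximal step. -/
theorem Bpsi_three_point {X0 : Set (Vec n)} (hX : Convex ℝ X0) {psi0 : Vec n → ℝ}
    {g0 : Vec n → Vec n} (hgrad : ∀ y ∈ X0, HasGradientWithinAt psi0 (g0 y) X0 y)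
    {a : ℝ} {q x xp z : V → Vec n} (hxp : xp ∈ prodSet V X0) (hz : z ∈ prodSet V X0)
    (hmin : ∀ y ∈ prodSet V X0,
      a * innV q xp + Bpsi psi0 g0 xp x ≤ a * innV q y + Bpsi psi0 g0 y x) :
    Bpsi psi0 g0 z xp - Bpsi psi0 g0 z x ≤ a * innV q (z - xp) - Bpsi psi0 g0 xp x := by
  have hderiv : HasDerivWithinAt
      (fun t : ℝ => ∑ i, (psi0 (xp i + t • (z i - xp i)) + t * ⟪a • q i - g0 (x i), z i - xp i⟫))
      (∑ i, (⟪g0 (xp i), z i - xp i⟫ + 1 * ⟪a • q i - g0 (x i), z i - xp i⟫))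
      (Set.Icc 0 1) 0 :=
    HasDerivWithinAt.fun_sum fun i _ =>
      (hasDerivWithinAt_comp_segment hX (hxp i) (hz i) (hgrad _ (hxp i))).add
        ((hasDerivWithinAt_id (0 : ℝ) (Set.Icc 0 1)).mul_const _)
  have h := nonneg_of_hasDerivWithinAt_of_le hderiv fun t ht => by
    have hm := hmin (fun i => xp i + t • (z i - xp i))
      fun i => hX.add_smul_sub_mem (hxp i) (hz i) ht
    simp only [Bpsi, innV, inner_add_right, inner_sub_right, real_inner_smul_right,
      sum_add_distrib, sum_sub_distrib, ← mul_sum] at hm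
    simp only [inner_sub_left, inner_sub_right, real_inner_smul_left, sum_add_distrib,
      sum_sub_distrib, ← mul_sum, zero_smul, add_zero, zero_mul]
    linarith
  simp only [inner_sub_left, inner_sub_right, real_inner_smul_left, sum_add_distrib,
    sum_sub_distrib, ← mul_sum, one_mul] at h
  simp only [Bpsi, innV, inner_sub_right, Pi.sub_apply, sum_sub_distrib]
  linarith

end Convex

/-- **One-step descent estimate for the explicit scheme (inequality (14)).**
Under the standing assumptions, consider one step of the explicit scheme with step size
`αᵏ > 0`, let `λ` be the largest eigenvalue of `L_d(G)` and `c = d − αᵏ s` entrywise.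
Then `V(xᵏ⁺¹, uᵏ⁺¹) − V(xᵏ, uᵏ) ≤ αᵏ⟨gᵏ + E_s(G)u*, x* − xᵏ⁺¹⟩ − (αᵏ/2)⟨L_d(G)xᵏ, xᵏ⟩
  − ((1 − αᵏλ)/2)‖xᵏ⁺¹ − xᵏ‖₂² − (αᵏ/2)⟨L_c(G)xᵏ⁺¹, xᵏ⁺¹⟩`. -/
theorem msd_explicit_one_step_descent
    {n : ℕ} {V Ed : Type*} [Fintype V] [Fintype Ed] [DecidableEq V]
    -- the graph: a fixed orientation of a finite, undirected, connected graph
    (head tail : Ed → V)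
    (hLoop : ∀ e, head e ≠ tail e)
    (hSimple : Function.Injective fun e => Sym2.mk (head e, tail e))
    (hConn : (SimpleGraph.fromRel fun i j => ∃ e, head e = i ∧ tail e = j).Connected)
    -- strictly positive edge weights s and d
    (sw dw : Ed → ℝ) (hsw : ∀ e, 0 < sw e) (hdw : ∀ e, 0 < dw e)
    -- the local constraint set X₀ and the distance generating function ψ₀
    (X0 : Set (Vec n)) (hX0closed : IsClosed X0) (hX0convex : Convex ℝ X0)
    (psi0 : Vec n → ℝ) (g0 : Vec n → Vec n)
    (hpsi0grad : ∀ y ∈ X0, HasGradientWithinAt psi0 (g0 y) X0 y)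
    (hpsi0C1 : ContinuousOn g0 X0)
    (hpsi0SC : ConvexOn ℝ X0 (fun y => psi0 y - (1/2) * ‖y‖^2))
    -- proper closed convex local costs fᵢ
    (f : V → Vec n → ℝ)
    (hfconv : ∀ i, ConvexOn ℝ X0 (f i))
    (hflsc : ∀ i, LowerSemicontinuousOn (f i) X0)
    -- a primal-dual (saddle) point (x*, u*) with g* ∈ ∂f(x*)
    (xstar : V → Vec n) (ustar : Ed → Vec n) (gstar : V → Vec n)
    (hxstarMem : xstar ∈ prodSet V X0)
    (hgstar : IsSubgrad (sumF f) (prodSet V X0) xstar gstar)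
    (hprimal : esTOp head tail sw xstar = 0)
    (hdual : ∀ x' ∈ prodSet V X0, innV (-gstar - esOp head tail sw ustar) (x' - xstar) ≤ 0)
    -- λ is the largest eigenvalue of L_d(G)
    (lam : ℝ)
    (hlamEig : ∃ v : V → Vec n, v ≠ 0 ∧ lapOp head tail dw v = lam • v)
    (hlamMax : ∀ μ : ℝ, (∃ v : V → Vec n, v ≠ 0 ∧ lapOp head tail dw v = μ • v) → μ ≤ lam)
    -- one step of the explicit scheme (MSD-ex) with step size αᵏ > 0
    (alphak : ℝ) (halphak : 0 < alphak)
    (xk xkp : V → Vec n) (uk ukp : Ed → Vec n) (gk : V → Vec n)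
    (hxkMem : xk ∈ prodSet V X0)
    (hgk : IsSubgrad (sumF f) (prodSet V X0) xk gk)
    (hxUpd : xkp ∈ prodSet V X0 ∧ ∀ y ∈ prodSet V X0,
      alphak * innV (gk + (lapOp head tail dw xk + esOp head tail sw uk)) xkp
          + Bpsi psi0 g0 xkp xk
        ≤ alphak * innV (gk + (lapOp head tail dw xk + esOp head tail sw uk)) y
          + Bpsi psi0 g0 y xk)
    (huUpd : ukp = uk + alphak • esTOp head tail sw xkp) :
    Vlyap psi0 g0 xstar ustar xkp ukp - Vlyap psi0 g0 xstar ustar xk uk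
      ≤ alphak * innV (gk + esOp head tail sw ustar) (xstar - xkp)
        - alphak / 2 * innV (lapOp head tail dw xk) xk
        - (1 - alphak * lam) / 2 * innV (xkp - xk) (xkp - xk)
        - alphak / 2 * innV (lapOp head tail (fun e => dw e - alphak * sw e) xkp) xkp := by
  obtain ⟨hxkp, hmin⟩ := hxUpd
  have hthree := Bpsi_three_point hX0convex hpsi0grad hxkp hxstarMem hmin
  have hstrong := half_innV_le_Bpsi hpsi0grad hpsi0SC hxkp hxkMem
  have hray := innV_lapOp_self_le head tail dw hlamMax (xkp - xk)
  have hsub := innV_lapOp_sub_self head tail dw xkp xk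
  have hstar0 : innV (lapOp head tail dw xk) xstar = 0 := by
    simp [innV_lapOp, edgeDiff_eq_zero_of_esTOp_eq_zero head tail hsw hprimal]
  have hE (u : Ed → Vec n) : innV (esOp head tail sw u) xstar = 0 := by
    simp [innV_esOp, hprimal, innE]
  have hu : innE (ukp - ustar) (ukp - ustar) = innE (uk - ustar) (uk - ustar)
      + 2 * alphak * (innV (esOp head tail sw uk) xkp - innV (esOp head tail sw ustar) xkp)
      + alphak ^ 2 * innV (lapOp head tail sw xkp) xkp := by
    rw [innV_esOp, innV_esOp, ← innE_esTOp_self head tail hsw, huUpd]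
    simp only [innE, mul_sum, ← sum_sub_distrib, ← sum_add_distrib]
    refine sum_congr rfl fun e _ => ?_
    simp only [Pi.sub_apply, Pi.add_apply, Pi.smul_apply]
    rw [add_sub_right_comm, real_inner_add_add_self, real_inner_smul_left,
      real_inner_smul_right, real_inner_smul_right, inner_sub_left (uk e) (ustar e) (esTOp head tail sw xkp e)]
    ring
  have hray' := mul_le_mul_of_nonneg_left hray halphak.le
  rw [hsub] at hray'
  simp only [innV_add_left, innV_sub_right, hstar0, hE] at hthree
  rw [innV_lapOp_sub_smul, innV_add_left, innV_sub_right gk,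
    innV_sub_right (esOp head tail sw ustar), hE]
  simp only [Vlyap, hu]
  linarith
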